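/- Let f be a C^3 multicritical circle map with N critical points, irrational rotation number α = [a_1, a_2, …] and unique invariant Borel probability measure μ, and consider the dynamical partitions P_n associated to a critical point c of f. For every 0 < γ < 1, every n ≥ 1 and every 0 ≤ i < q_n, one has μ(A^n_{i,γ}) ≥ δ_n·(a_{n+1} − (4N + 2)·a_{n+1}^γ), where δ_n = μ(I_n). -/

import Mathlib

open MeasureTheory Set Filter
open scoped ENNReal NNReal

noncomputable section

/-- The circle `S¹ = ℝ/ℤ`. -/
abbrev Circle1 := AddCircle (1 : ℝ)

/-- Projection `ℝ → S¹`. -/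
def projC (x : ℝ) : Circle1 := (x : Circle1)

/-- An orientation-preserving circle homeomorphism, given together with a
(strictly monotone, continuous) lift `F : ℝ → ℝ` satisfying `F (x+1) = F x + 1`. -/
structure CircleHomeo where
  toHomeo : Circle1 ≃ₜ Circle1
  lift : ℝ → ℝ
  lift_strictMono : StrictMono lift
  lift_continuous : Continuous lift
  lift_add_one : ∀ x : ℝ, lift (x + 1) = lift x + 1
  lift_proj : ∀ x : ℝ, toHomeo (projC x) = projC (lift x)

/-- The underlying map `S¹ → S¹`. -/
def CircleHomeo.toFun (H : CircleHomeo) : Circle1 → Circle1 := H.toHomeo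

/-- `α ∈ [0,1)` is the rotation number of `H`: `α = lim Fⁿ(x)/n (mod 1)`. -/
def HasRotationNumber (H : CircleHomeo) (α : ℝ) : Prop :=
  α ∈ Set.Ico (0 : ℝ) 1 ∧ ∃ β : ℝ, Int.fract β = α ∧
    ∀ x : ℝ, Filter.Tendsto (fun n : ℕ => H.lift^[n] x / n) Filter.atTop (nhds β)

/-- `μ` is an invariant Borel probability measure for `H`. -/
def IsInvProbMeasure (H : CircleHomeo) (μ : Measure Circle1) : Prop :=
  IsProbabilityMeasure μ ∧ μ.map H.toFun = μ

/-- Hausdorff dimension of a measure: `inf {dim_H X : μ X = 1}`. -/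
def dimHMeasure (μ : Measure Circle1) : ℝ≥0∞ :=
  ⨅ (X : Set Circle1) (_ : MeasurableSet X) (_ : μ X = 1), dimH X

/-- The set `D(γ,τ)` of Diophantine numbers of type `(γ,τ)`. -/
def DiophClass (γ τ : ℝ) : Set ℝ :=
  {α : ℝ | ∀ p q : ℤ, q ≠ 0 → γ / |(q : ℝ)| ^ (τ + 2) ≤ |α - (p : ℝ) / (q : ℝ)|}

/-- The set `D_τ = ⋃_{γ > 0} D(γ,τ)`. -/
def DiophTau (τ : ℝ) : Set ℝ := {α : ℝ | ∃ γ > 0, α ∈ DiophClass γ τ}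

/-- Iterates of the Gauss map, starting from `α`. -/
def gaussIter (α : ℝ) : ℕ → ℝ
  | 0 => α
  | n + 1 => Int.fract (1 / gaussIter α n)

/-- The `n`-th partial quotient `a_n` (`n ≥ 1`) of the continued fraction of `α`. -/
def cfA (α : ℝ) (n : ℕ) : ℕ := ⌊1 / gaussIter α (n - 1)⌋₊

/-- Denominators of the convergents: `q_0 = 1`, `q_1 = a_1`, `q_n = a_n q_{n-1} + q_{n-2}`. -/
def cfQ (α : ℝ) : ℕ → ℕ
  | 0 => 1
  | 1 => cfA α 1
  | n + 2 => cfA α (n + 2) * cfQ α (n + 1) + cfQ α n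

/-- Positive displacement from `a` to `z` on the circle, a number in `[0,1)`. -/
def circDisp (a z : Circle1) : ℝ := (AddCircle.equivIco 1 0 (z - a)).1

/-- The circle arc `[a, b)`. -/
def arcIco (a b : Circle1) : Set Circle1 := {z : Circle1 | circDisp a z < circDisp a b}

namespace DynPart

/-- `x_i = f^i(x_0)`. -/
def pt (H : CircleHomeo) (x0 : Circle1) (i : ℕ) : Circle1 := H.toFun^[i] x0

/-- The interval `I_n`: `[x_0, x_{q_n})` for even `n`, `[x_{q_n}, x_0)` for odd `n`. -/
def In (H : CircleHomeo) (α : ℝ) (x0 : Circle1) (n : ℕ) : Set Circle1 :=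
  if Even n then arcIco x0 (pt H x0 (cfQ α n)) else arcIco (pt H x0 (cfQ α n)) x0

/-- `I_n^i = f^i(I_n)`. -/
def Ini (H : CircleHomeo) (α : ℝ) (x0 : Circle1) (n i : ℕ) : Set Circle1 :=
  H.toFun^[i] '' In H α x0 n

/-- The dynamical partition `P_n(x_0)`. -/
def part (H : CircleHomeo) (α : ℝ) (x0 : Circle1) (n : ℕ) : Set (Set Circle1) :=
  {S | ∃ i < cfQ α n, S = Ini H α x0 (n - 1) i} ∪
  {S | ∃ i < cfQ α (n - 1), S = Ini H α x0 n i}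

/-- `Δ^{(n)}_{i,j} = I_n^{i + q_{n-1} + j q_n}`. -/
def Δ (H : CircleHomeo) (α : ℝ) (x0 : Circle1) (n i j : ℕ) : Set Circle1 :=
  Ini H α x0 n (i + cfQ α (n - 1) + j * cfQ α n)

end DynPart

/-- `φ` is a `C³` diffeomorphism from the open set `U` onto the open set `V`. -/
def IsC3DiffeoOn (φ : ℝ → ℝ) (U V : Set ℝ) : Prop :=
  IsOpen U ∧ IsOpen V ∧ ContDiffOn ℝ 3 φ U ∧ Set.BijOn φ U V ∧ ∀ x ∈ U, deriv φ x ≠ 0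

/-- `c` is a critical point of power-law type with exponent `p`: in suitable `C³`
coordinates around `c` and `H c`, the map takes the form `x ↦ x |x|^{p-1}`. -/
def IsPowerLawCritPt (H : CircleHomeo) (c p : ℝ) : Prop :=
  ∃ (U V U' V' : Set ℝ) (φ ψ : ℝ → ℝ),
    c ∈ U ∧ H.lift c ∈ U' ∧ (0 : ℝ) ∈ V ∧ (0 : ℝ) ∈ V' ∧
    IsC3DiffeoOn φ U V ∧ IsC3DiffeoOn ψ U' V' ∧
    φ c = 0 ∧ ψ (H.lift c) = 0 ∧ Set.MapsTo H.lift U U' ∧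
    ∀ x ∈ U, ψ (H.lift x) = φ x * |φ x| ^ (p - 1)

/-- A `C³` multicritical circle map: an orientation-preserving `C³` circle
homeomorphism whose critical points are exactly `c_0, …, c_{N-1}` (represented in
`[0,1)`), each of power-law type with criticality `p_i > 1`. -/
structure MulticriticalCircleMap extends CircleHomeo where
  smooth : ContDiff ℝ 3 lift
  N : ℕ
  N_pos : 0 < N
  crit : Fin N → ℝ
  crit_mem : ∀ i, crit i ∈ Set.Ico (0 : ℝ) 1
  crit_inj : Function.Injective crit
  critExp : Fin N → ℝ
  critExp_gt_one : ∀ i, 1 < critExp i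
  crit_powerLaw : ∀ i, IsPowerLawCritPt toCircleHomeo (crit i) (critExp i)
  crit_complete : ∀ x : ℝ, deriv lift x = 0 → ∃ (i : Fin N) (k : ℤ), x = crit i + (k : ℝ)

/-- `z ∈ S¹` is a critical point of `f^m`. -/
def IsCritPtOfIter (f : MulticriticalCircleMap) (m : ℕ) (z : Circle1) : Prop :=
  ∃ x : ℝ, projC x = z ∧ deriv (f.lift^[m]) x = 0

/-- Indices `0 < j < a_{n+1} - 1` such that the closure of `Δ_j^{(n)}` contains a
critical point of `T_n = f^{q_n}`. -/
def critTimesSet (f : MulticriticalCircleMap) (α : ℝ) (x0 : Circle1) (n : ℕ) : Finset ℕ :=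
  @Finset.filter ℕ
    (fun j => ∃ z ∈ closure (DynPart.Δ f.toCircleHomeo α x0 n 0 j),
      IsCritPtOfIter f (cfQ α n) z)
    (Classical.decPred _)
    (Finset.Ioo 0 (cfA α (n + 1) - 1))

/-- The number `r_n` of bridges (`r_n = #{interior critical times} + 1`). -/
def rn (f : MulticriticalCircleMap) (α : ℝ) (x0 : Circle1) (n : ℕ) : ℕ :=
  (critTimesSet f α x0 n).card + 1

/-- The critical times `0 = k_0^{(n)} < k_1^{(n)} < … < k_{r_n}^{(n)} = a_{n+1} - 1`. -/
def kTime (f : MulticriticalCircleMap) (α : ℝ) (x0 : Circle1) (n : ℕ) (s : ℕ) : ℕ :=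
  (((0 : ℕ) :: (critTimesSet f α x0 n).sort (· ≤ ·)) ++ [cfA α (n + 1) - 1]).getD s
    (cfA α (n + 1) - 1)

/-- The `s`-th bridge `G_s^{(n)} = ⋃_{k_s < j < k_{s+1}} Δ_j^{(n)}`. -/
def bridge (f : MulticriticalCircleMap) (α : ℝ) (x0 : Circle1) (n s : ℕ) : Set Circle1 :=
  ⋃ j ∈ Set.Ioo (kTime f α x0 n s) (kTime f α x0 n (s + 1)),
    DynPart.Δ f.toCircleHomeo α x0 n 0 j

/-- The trimmed bridge `G_{s,γ}^{(n)}`. -/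
def bridgeGamma (f : MulticriticalCircleMap) (α : ℝ) (x0 : Circle1) (n : ℕ) (γ : ℝ)
    (s : ℕ) : Set Circle1 :=
  ⋃ j ∈ {j : ℕ | (kTime f α x0 n s : ℝ) + (cfA α (n + 1) : ℝ) ^ γ < (j : ℝ) ∧
      (j : ℝ) < (kTime f α x0 n (s + 1) : ℝ) + 1 - (cfA α (n + 1) : ℝ) ^ γ},
    DynPart.Δ f.toCircleHomeo α x0 n 0 j

/-- `A^n_{i,γ} = ⋃_{s < r_n} f^i(G_{s,γ}^{(n)})`. -/
def Aset (f : MulticriticalCircleMap) (α : ℝ) (x0 : Circle1) (n i : ℕ) (γ : ℝ) :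
    Set Circle1 :=
  ⋃ s ∈ Set.Iio (rn f α x0 n), f.toCircleHomeo.toFun^[i] '' bridgeGamma f α x0 n γ s

/-- `A^n_γ = ⋃_{i < q_n} A^n_{i,γ}`. -/
def AsetAll (f : MulticriticalCircleMap) (α : ℝ) (x0 : Circle1) (n : ℕ) (γ : ℝ) :
    Set Circle1 :=
  ⋃ i ∈ Set.Iio (cfQ α n), Aset f α x0 n i γ

/-- The Schwarzian derivative `Sf = f'''/f' - (3/2)(f''/f')²`. -/
def schwarzianAt (f : ℝ → ℝ) (x : ℝ) : ℝ :=
  iteratedDeriv 3 f x / deriv f x - 3 / 2 * (iteratedDeriv 2 f x / deriv f x) ^ 2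

end

/-! ### Continued fractions -/

/-- Numerators of the convergents. -/
noncomputable def cfP (α : ℝ) : ℕ → ℤ
  | 0 => 0
  | 1 => 1
  | n + 2 => cfA α (n + 2) * cfP α (n + 1) + cfP α n

theorem gaussIter_irrational {α : ℝ} (hα : Irrational α) (n : ℕ) : Irrational (gaussIter α n) := by
  induction n with
  | zero => exact hα
  | succ n ih =>
    have h : Irrational (1 / gaussIter α n) := by simpa using ih.inv
    have := h.sub_intCast ⌊1 / gaussIter α n⌋
    simpa only [gaussIter, Int.fract] using this

theorem gaussIter_mem {α : ℝ} (hα : Irrational α) (h : α ∈ Ico (0 : ℝ) 1) (n : ℕ) :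
    gaussIter α n ∈ Ioo (0 : ℝ) 1 := by
  have hne := (gaussIter_irrational hα n).ne_zero
  have : gaussIter α n ∈ Ico (0 : ℝ) 1 := by
    cases n with
    | zero => exact h
    | succ n => exact ⟨Int.fract_nonneg _, Int.fract_lt_one _⟩
  exact ⟨lt_of_le_of_ne this.1 hne.symm, this.2⟩

theorem gaussIter_succ {α : ℝ} (hα : Irrational α) (h : α ∈ Ico (0 : ℝ) 1) (n : ℕ) :
    gaussIter α (n + 1) = 1 / gaussIter α n - cfA α (n + 1) := by
  have h0 : 0 ≤ 1 / gaussIter α n := by have := (gaussIter_mem hα h n).1; positivity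
  simp only [gaussIter, cfA, Nat.add_sub_cancel, Int.fract]
  rw [natCast_floor_eq_intCast_floor h0]

theorem one_le_cfA {α : ℝ} (hα : Irrational α) (h : α ∈ Ico (0 : ℝ) 1) (n : ℕ) :
    1 ≤ cfA α n := by
  have := gaussIter_mem hα h (n - 1)
  rw [cfA, Nat.le_floor_iff (by have := this.1; positivity), Nat.cast_one, le_div_iff₀ this.1]
  linarith [this.2]

theorem cfQ_pos {α : ℝ} (hα : Irrational α) (h : α ∈ Ico (0 : ℝ) 1) : ∀ n, 0 < cfQ α n
  | 0 => Nat.one_pos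
  | 1 => one_le_cfA hα h 1
  | n + 2 => by
    have := cfQ_pos hα h n
    rw [cfQ]
    positivity

theorem cfQ_succ {α : ℝ} {n : ℕ} (hn : 1 ≤ n) :
    cfQ α (n + 1) = cfA α (n + 1) * cfQ α n + cfQ α (n - 1) := by
  obtain ⟨m, rfl⟩ := Nat.exists_eq_add_of_le' hn
  rfl

/-- The distance `δ_n = |q_n α - p_n|`, as a product of iterates of the Gauss map. -/
noncomputable def cfDelta (α : ℝ) (n : ℕ) : ℝ := ∏ k ∈ Finset.range (n + 1), gaussIter α k

theorem cfDelta_mem {α : ℝ} (hα : Irrational α) (h : α ∈ Ico (0 : ℝ) 1) (n : ℕ) :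
    cfDelta α n ∈ Ioo (0 : ℝ) 1 := by
  induction n with
  | zero => simpa [cfDelta] using gaussIter_mem hα h 0
  | succ n ih =>
    have := gaussIter_mem hα h (n + 1)
    rw [cfDelta, Finset.prod_range_succ]
    exact ⟨mul_pos ih.1 this.1, mul_lt_one_of_nonneg_of_lt_one_left ih.1.le ih.2 this.2.le⟩

theorem cfQ_mul_sub_cfP {α : ℝ} (hα : Irrational α) (h : α ∈ Ico (0 : ℝ) 1) :
    ∀ n, cfQ α n * α - cfP α n = (-1) ^ n * cfDelta α n
  | 0 => by simp [cfQ, cfP, cfDelta, gaussIter]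
  | 1 => by
    have h0 := (gaussIter_mem hα h 0).1.ne'
    have h1 := gaussIter_succ hα h 0
    simp only [zero_add] at h1
    simp only [cfDelta, Finset.prod_range_succ, Finset.prod_range_zero, h1, cfQ, cfP]
    simp only [gaussIter] at h0 ⊢
    field_simp
    push_cast
    ring
  | n + 2 => by
    have h0 := (gaussIter_mem hα h (n + 1)).1.ne'
    have ih0 := cfQ_mul_sub_cfP hα h n
    have ih1 := cfQ_mul_sub_cfP hα h (n + 1)
    have e1 : cfDelta α (n + 1) = cfDelta α n * gaussIter α (n + 1) :=
      Finset.prod_range_succ _ _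
    have e2 : cfDelta α (n + 2) = cfDelta α (n + 1) * gaussIter α (n + 2) :=
      Finset.prod_range_succ _ _
    have e3 : cfDelta α (n + 2) = cfDelta α n - cfA α (n + 2) * cfDelta α (n + 1) := by
      rw [e2, gaussIter_succ hα h (n + 1), e1]
      field_simp
    rw [cfQ, cfP, e3]
    push_cast
    linear_combination ih0 + (cfA α (n + 2) : ℝ) * ih1

theorem cfP_det {α : ℝ} (n : ℕ) :
    cfP α (n + 1) * cfQ α n - cfP α n * cfQ α (n + 1) = (-1) ^ n := by
  induction n with
  | zero => simp [cfP, cfQ]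
  | succ n ih =>
    rw [cfP, cfQ]
    push_cast
    linear_combination -ih

/-- The convergents are best approximations. -/
theorem cfDelta_le_abs {α : ℝ} (hα : Irrational α) (h : α ∈ Ico (0 : ℝ) 1) (n : ℕ) {d : ℤ}
    (hd : 0 < d) (hdq : d < cfQ α (n + 1)) (k : ℤ) : cfDelta α n ≤ |d * α + k| := by
  have h0 := cfQ_mul_sub_cfP hα h n
  have h1 := cfQ_mul_sub_cfP hα h (n + 1)
  have hq0 : (0 : ℤ) < cfQ α n := mod_cast cfQ_pos hα h n
  have hq1 : (0 : ℤ) < cfQ α (n + 1) := mod_cast cfQ_pos hα h (n + 1)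
  have hδ0 := (cfDelta_mem hα h n).1
  have hδ1 := (cfDelta_mem hα h (n + 1)).1
  have hdet := cfP_det (α := α) n
  have hs : (-1 : ℤ) ^ n * (-1) ^ n = 1 := by rw [← mul_pow]; norm_num
  obtain ⟨u, v, hu, hv⟩ : ∃ u v : ℤ, d = u * cfQ α n + v * cfQ α (n + 1) ∧
      -k = u * cfP α n + v * cfP α (n + 1) := by
    refine ⟨(-1) ^ n * (d * cfP α (n + 1) + k * cfQ α (n + 1)),
      (-1) ^ n * (-k * cfQ α n - d * cfP α n), ?_, ?_⟩
    · linear_combination (-d) * hs - (-1) ^ n * d * hdet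
    · linear_combination k * hs + (-1) ^ n * k * hdet
  have key : |(d : ℝ) * α + k| = |u * cfDelta α n - v * cfDelta α (n + 1)| := by
    have hu' : (d : ℝ) = u * cfQ α n + v * cfQ α (n + 1) := mod_cast hu
    have hv' : -(k : ℝ) = u * cfP α n + v * cfP α (n + 1) := mod_cast hv
    have : (d : ℝ) * α + k = (-1) ^ n * (u * cfDelta α n - v * cfDelta α (n + 1)) := by
      rw [pow_succ] at h1
      linear_combination α * hu' - hv' + u * h0 + v * h1
    rw [this, abs_mul, abs_pow, abs_neg, abs_one, one_pow, one_mul]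
  rw [key]
  rcases lt_trichotomy v 0 with hv0 | rfl | hv0
  · have hu1 : 1 ≤ u := by
      by_contra! hc
      nlinarith
    have hu1' : (1 : ℝ) ≤ u := mod_cast hu1
    have hv0' : (v : ℝ) < 0 := mod_cast hv0
    refine le_trans ?_ (le_abs_self _)
    nlinarith
  · have hu1 : 1 ≤ u := by
      by_contra! hc
      nlinarith
    have hu1' : (1 : ℝ) ≤ u := mod_cast hu1
    refine le_trans ?_ (le_abs_self _)
    push_cast
    nlinarith
  · have hu1 : u ≤ -1 := by
      by_contra! hc
      have : 0 ≤ u := by lia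
      nlinarith
    have hu1' : (u : ℝ) ≤ -1 := mod_cast hu1
    have hv0' : (0 : ℝ) < v := mod_cast hv0
    refine le_trans ?_ (neg_le_abs _)
    nlinarith

/-! ### Order of the orbits of the lift -/

namespace CircleHomeo

variable (H : CircleHomeo)

theorem lift_add_int (x : ℝ) (k : ℤ) : H.lift (x + k) = H.lift x + k := by
  let g : CircleDeg1Lift := ⟨⟨H.lift, H.lift_strictMono.monotone⟩, H.lift_add_one⟩
  exact g.map_add_int x k

theorem iterate_lift_add_int (m : ℕ) (x : ℝ) (k : ℤ) :
    H.lift^[m] (x + k) = H.lift^[m] x + k := by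
  induction m generalizing x with
  | zero => rfl
  | succ m ih => rw [Function.iterate_succ_apply, lift_add_int, ih, Function.iterate_succ_apply]

theorem iterate_toFun_projC (m : ℕ) (x : ℝ) : H.toFun^[m] (projC x) = projC (H.lift^[m] x) := by
  induction m generalizing x with
  | zero => rfl
  | succ m ih =>
    rw [Function.iterate_succ_apply, Function.iterate_succ_apply, ← ih]
    exact congrArg _ (H.lift_proj x)

variable {H} {β : ℝ}

theorem le_of_iterate_lift_le (hβ : ∀ x : ℝ, Tendsto (fun n : ℕ => H.lift^[n] x / n) atTop (nhds β))
    {m m' : ℕ} {p : ℤ} {x : ℝ} (h : H.lift^[m] x ≤ H.lift^[m'] x + p) :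
    m * β ≤ m' * β + p := by
  have hlin : ∀ k : ℕ, Tendsto (fun n : ℕ => H.lift^[k * n] x / n) atTop (nhds (k * β)) := by
    intro k
    rcases k.eq_zero_or_pos with rfl | hk
    · simpa using tendsto_const_div_atTop_nhds_zero_nat x
    · have := ((hβ x).comp (tendsto_id.const_mul_atTop' hk)).const_mul (k : ℝ)
      refine this.congr fun n => ?_
      simp only [Function.comp, id]
      push_cast
      field_simp
  have hmono : ∀ k, Monotone H.lift^[k] := fun k => H.lift_strictMono.monotone.iterate k
  have hcomm : Function.Commute H.lift^[m] (fun y => H.lift^[m'] y + p) := by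
    intro y
    simp only [H.iterate_lift_add_int m, ← Function.iterate_add_apply, add_comm m]
  have hiter : ∀ n : ℕ, (fun y => H.lift^[m'] y + p)^[n] x = H.lift^[m' * n] x + n * p := by
    intro n
    induction n with
    | zero => simp
    | succ n ih =>
      have := H.iterate_lift_add_int m' (H.lift^[m' * n] x) (n * p)
      rw [← Function.iterate_add_apply] at this
      push_cast at this
      rw [Function.iterate_succ_apply', ih, this, mul_add, mul_one, add_comm m']
      push_cast
      ring
  have hle : ∀ n : ℕ, H.lift^[m * n] x ≤ H.lift^[m' * n] x + n * p := by
    intro n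
    rw [← hiter, Function.iterate_mul]
    exact hcomm.iterate_le_of_map_le (hmono m) (fun a b hab => by simpa using hmono m' hab) h n
  refine le_of_tendsto_of_tendsto (hlin m) ((hlin m').add_const (p : ℝ)) ?_
  filter_upwards [eventually_gt_atTop 0] with n hn
  have hn' : (0 : ℝ) < n := mod_cast hn
  rw [div_add' _ _ _ hn'.ne']
  gcongr
  linarith [hle n]

/-- The orbits of the lift are ordered as those of the translation by `β`. -/
theorem iterate_lift_lt_iff (hβ : ∀ x : ℝ, Tendsto (fun n : ℕ => H.lift^[n] x / n) atTop (nhds β))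
    (hirr : Irrational β) {m m' : ℕ} {p p' : ℤ} {x : ℝ} :
    H.lift^[m] x + p < H.lift^[m'] x + p' ↔ m * β + p < m' * β + p' := by
  have hle : ∀ {m m' : ℕ} {p p' : ℤ}, H.lift^[m] x + p ≤ H.lift^[m'] x + p' →
      m * β + p ≤ m' * β + p' := by
    intro m m' p p' h
    have := le_of_iterate_lift_le hβ (m := m) (m' := m') (p := p' - p) (x := x)
      (by push_cast; linarith)
    push_cast at this
    linarith
  refine ⟨fun h => lt_of_le_of_ne (hle h.le) fun heq => ?_, fun h => ?_⟩
  · have hm : (m : ℤ) - m' = 0 := by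
      by_contra hne
      exact ((hirr.intCast_mul hne).add_intCast (p - p')).ne_zero (by push_cast; linarith)
    have hm' : m = m' := by lia
    subst hm'
    linarith
  · by_contra! hc
    exact (hle hc).not_gt h

theorem iterate_lift_le_iff (hβ : ∀ x : ℝ, Tendsto (fun n : ℕ => H.lift^[n] x / n) atTop (nhds β))
    (hirr : Irrational β) {m m' : ℕ} {p p' : ℤ} {x : ℝ} :
    H.lift^[m] x + p ≤ H.lift^[m'] x + p' ↔ m * β + p ≤ m' * β + p' := by
  simpa only [not_lt] using (iterate_lift_lt_iff hβ hirr).not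

end CircleHomeo

/-! ### Arcs of the circle -/

theorem projC_eq_projC_iff {x y : ℝ} : projC x = projC y ↔ ∃ k : ℤ, x = y + k := by
  rw [projC, projC, ← sub_eq_zero, ← AddCircle.coe_sub, AddCircle.coe_eq_zero_iff]
  refine exists_congr fun k => ?_
  rw [zsmul_eq_mul, mul_one, eq_sub_iff_add_eq', eq_comm]

theorem circDisp_projC {a z : ℝ} (hz : z ∈ Ico a (a + 1)) :
    circDisp (projC a) (projC z) = z - a := by
  have : z - a ∈ Ico (0 : ℝ) (0 + 1) := ⟨by linarith [hz.1], by linarith [hz.2]⟩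
  rw [circDisp, projC, projC, ← AddCircle.coe_sub, AddCircle.equivIco_coe_eq this]

theorem arcIco_projC {a b : ℝ} (hb : b ∈ Ico a (a + 1)) :
    arcIco (projC a) (projC b) = projC '' Ico a b := by
  ext z
  constructor
  · intro hz
    obtain ⟨w, hw, rfl⟩ : ∃ w ∈ Ico a (a + 1), projC w = z :=
      ⟨_, (AddCircle.equivIco 1 a z).2, AddCircle.coe_equivIco⟩
    rw [arcIco, Set.mem_ofPred_eq, circDisp_projC hw, circDisp_projC hb] at hz
    exact ⟨w, ⟨hw.1, by linarith⟩, rfl⟩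
  · rintro ⟨w, hw, rfl⟩
    rw [arcIco, Set.mem_ofPred_eq, circDisp_projC ⟨hw.1, hw.2.trans hb.2⟩, circDisp_projC hb]
    linarith [hw.2]

theorem measurableSet_arcIco (a b : Circle1) : MeasurableSet (arcIco a b) := by
  have h : Measurable (circDisp a) :=
    measurable_subtype_coe.comp
      ((AddCircle.measurableEquivIco 1 0).measurable.comp (measurable_id.sub_const a))
  exact measurableSet_lt h measurable_const

/-! ### Dynamical partitions -/

theorem CircleHomeo.iterate_lift_mem_Icc (H : CircleHomeo) {a b : ℝ} {p q : ℤ} (k i j : ℕ) {w : ℝ}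
    (ha : H.lift^[i] a + p ≤ w) (hb : w ≤ H.lift^[j] b + q) :
    H.lift^[k] w ∈ Icc (H.lift^[k + i] a + p) (H.lift^[k + j] b + q) := by
  have hmono : Monotone H.lift^[k] := H.lift_strictMono.monotone.iterate k
  have h1 := hmono ha
  have h2 := hmono hb
  rw [H.iterate_lift_add_int, ← Function.iterate_add_apply] at h1 h2
  exact ⟨h1, h2⟩

/-- The arc `I_n` based at `projC x` is the projection of the interval from `F^s x + u` to
`F^t x + v`, where `F` is the lift of `H`, and this interval has length `δ_n` in the coordinates
in which `F` is the translation by `β`. -/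
structure IsLiftOfIn (H : CircleHomeo) (α β x : ℝ) (n s t : ℕ) (u v : ℤ) : Prop where
  tendsto : ∀ x : ℝ, Tendsto (fun n : ℕ => H.lift^[n] x / n) atTop (nhds β)
  fract_eq : Int.fract β = α
  irrational : Irrational α
  left_le : s ≤ cfQ α n
  right_le : t ≤ cfQ α n
  length_eq : t * β + v = s * β + u + cfDelta α n
  In_eq : DynPart.In H α (projC x) n = projC '' Ico (H.lift^[s] x + u) (H.lift^[t] x + v)

theorem exists_isLiftOfIn {H : CircleHomeo} {α : ℝ} (hirr : Irrational α)
    (hrot : HasRotationNumber H α) (x : ℝ) (n : ℕ) :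
    ∃ (β : ℝ) (s t : ℕ) (u v : ℤ), IsLiftOfIn H α β x n s t u v := by
  obtain ⟨hα, β, hfract, hβ⟩ := hrot
  have hβα : β = α + ⌊β⌋ := by rw [← hfract, Int.fract_add_floor]
  have hirrβ : Irrational β := hβα ▸ hirr.add_intCast _
  have hcf := cfQ_mul_sub_cfP hirr hα n
  obtain ⟨hδ0, hδ1⟩ := cfDelta_mem hirr hα n
  have hpt : ∀ p : ℤ, DynPart.pt H (projC x) (cfQ α n) =
      projC (H.lift^[cfQ α n] x + p) := fun p => by
    rw [DynPart.pt, H.iterate_toFun_projC, eq_comm, projC_eq_projC_iff]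
    exact ⟨p, rfl⟩
  set p : ℤ := -(cfP α n + cfQ α n * ⌊β⌋) with hp
  have hqβ : cfQ α n * β + p = (-1) ^ n * cfDelta α n := by
    rw [← hcf, hp, hβα]
    simp only [Int.floor_add_intCast, Int.floor_eq_zero_iff.2 hα]
    push_cast
    ring
  have hlt := fun {m m' : ℕ} {p p' : ℤ} =>
    CircleHomeo.iterate_lift_lt_iff hβ hirrβ (m := m) (m' := m') (p := p) (p' := p') (x := x)
  rcases n.even_or_odd with he | ho
  · rw [he.neg_one_pow, one_mul] at hqβ
    refine ⟨β, 0, cfQ α n, 0, p, hβ, hfract, hirr, Nat.zero_le _, le_rfl, ?_, ?_⟩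
    · push_cast; linarith
    · have h1 := (hlt (m := 0) (p := 0) (m' := cfQ α n) (p' := p)).2 (by push_cast; linarith)
      have h2 := (hlt (m := cfQ α n) (p := p) (m' := 0) (p' := 1)).2 (by push_cast; linarith)
      simp only [Function.iterate_zero, id, Int.cast_zero, Int.cast_one, add_zero] at h1 h2 ⊢
      rw [DynPart.In, if_pos he, hpt p, arcIco_projC ⟨h1.le, h2⟩]
  · rw [ho.neg_one_pow, neg_one_mul] at hqβ
    refine ⟨β, cfQ α n, 0, p, 0, hβ, hfract, hirr, le_rfl, Nat.zero_le _, ?_, ?_⟩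
    · push_cast; linarith
    · have h1 := (hlt (m := cfQ α n) (p := p) (m' := 0) (p' := 0)).2 (by push_cast; linarith)
      have h2 := (hlt (m := 0) (p := 0) (m' := cfQ α n) (p' := p + 1)).2 (by push_cast; linarith)
      simp only [Function.iterate_zero, id, Int.cast_zero, Int.cast_add, Int.cast_one,
        add_zero] at h1 h2 ⊢
      rw [DynPart.In, if_neg (Nat.not_even_iff_odd.2 ho), hpt p, arcIco_projC ⟨h1.le, by linarith⟩]

namespace IsLiftOfIn

variable {H : CircleHomeo} {α β x : ℝ} {n s t : ℕ} {u v : ℤ}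

theorem mem_Ico (h : IsLiftOfIn H α β x n s t u v) : α ∈ Ico (0 : ℝ) 1 :=
  h.fract_eq ▸ ⟨Int.fract_nonneg _, Int.fract_lt_one _⟩

theorem irrational' (h : IsLiftOfIn H α β x n s t u v) : Irrational β := by
  have := h.irrational.add_intCast ⌊β⌋
  rwa [← h.fract_eq, Int.fract_add_floor] at this

theorem delta_pos (h : IsLiftOfIn H α β x n s t u v) : 0 < cfDelta α n :=
  (cfDelta_mem h.irrational h.mem_Ico n).1

theorem delta_le_abs (h : IsLiftOfIn H α β x n s t u v) {d : ℤ} (hd : 0 < d)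
    (hdq : d < cfQ α (n + 1)) (k : ℤ) : cfDelta α n ≤ |d * β + k| := by
  have := cfDelta_le_abs h.irrational h.mem_Ico n hd hdq (d * ⌊β⌋ + k)
  convert this using 2
  rw [← h.fract_eq, Int.fract]
  push_cast
  ring

/-- Two translates of the first `q_{n+1}` images of the lift of `I_n` only meet if they come from
the same image. -/
theorem eq_of_overlap (h : IsLiftOfIn H α β x n s t u v) {m m' : ℕ} {k k' : ℤ}
    (hm : m < cfQ α (n + 1)) (hm' : m' < cfQ α (n + 1))
    (h1 : H.lift^[m + s] x + u + k < H.lift^[m' + t] x + v + k')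
    (h2 : H.lift^[m' + s] x + u + k' < H.lift^[m + t] x + v + k) : m = m' := by
  wlog hlt : m < m' generalizing m m' k k'
  · by_contra hne
    exact hne (this hm' hm h2 h1 (by lia)).symm
  have hlen := h.length_eq
  have h1' := (CircleHomeo.iterate_lift_lt_iff h.tendsto h.irrational' (x := x)
    (m := m + s) (m' := m' + t) (p := u + k) (p' := v + k')).1 (by push_cast; linarith)
  have h2' := (CircleHomeo.iterate_lift_lt_iff h.tendsto h.irrational' (x := x)
    (m := m' + s) (m' := m + t) (p := u + k') (p' := v + k)).1 (by push_cast; linarith)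
  have := h.delta_le_abs (d := (m' : ℤ) - m) (by lia) (by lia) (k' - k)
  push_cast at h1' h2' this
  exact absurd this (not_le.2 (abs_lt.2 ⟨by linarith, by linarith⟩))

theorem Ini_subset (h : IsLiftOfIn H α β x n s t u v) (m : ℕ) :
    DynPart.Ini H α (projC x) n m ⊆
      projC '' Ico (H.lift^[m + s] x + u) (H.lift^[m + t] x + v) := by
  rw [DynPart.Ini, h.In_eq]
  rintro _ ⟨_, ⟨w, hw, rfl⟩, rfl⟩
  rw [H.iterate_toFun_projC]
  have hmono : StrictMono H.lift^[m] := H.lift_strictMono.iterate m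
  have h1 := hmono.monotone hw.1
  have h2 := hmono hw.2
  rw [H.iterate_lift_add_int, ← Function.iterate_add_apply] at h1 h2
  exact ⟨_, ⟨h1, h2⟩, rfl⟩

theorem disjoint_Ini (h : IsLiftOfIn H α β x n s t u v) {m m' : ℕ} (hm : m < cfQ α (n + 1))
    (hm' : m' < cfQ α (n + 1)) (hne : m ≠ m') :
    Disjoint (DynPart.Ini H α (projC x) n m) (DynPart.Ini H α (projC x) n m') := by
  refine Set.disjoint_left.2 fun z hz hz' => hne ?_
  obtain ⟨w, hw, rfl⟩ := h.Ini_subset m hz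
  obtain ⟨w', hw', heq⟩ := h.Ini_subset m' hz'
  obtain ⟨k, rfl⟩ := projC_eq_projC_iff.1 heq
  refine h.eq_of_overlap (k := k) (k' := 0) hm hm' ?_ ?_ <;> push_cast <;>
    linarith [hw.1, hw.2, hw'.1, hw'.2]

theorem closure_Ini_subset (h : IsLiftOfIn H α β x n s t u v) (m : ℕ) :
    closure (DynPart.Ini H α (projC x) n m) ⊆
      projC '' Icc (H.lift^[m + s] x + u) (H.lift^[m + t] x + v) := by
  refine closure_minimal ((h.Ini_subset m).trans (image_mono Ico_subset_Icc_self)) ?_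
  exact (isCompact_Icc.image (AddCircle.continuous_mk' 1)).isClosed

/-- The base point is not in the closure of `I_n^m` when `0 < m` and `m + q_n < q_{n+1}`. -/
theorem base_notMem_Icc (h : IsLiftOfIn H α β x n s t u v) {m : ℕ} (hm : 0 < m)
    (hmq : m + cfQ α n < cfQ α (n + 1)) (k : ℤ) :
    x + k ∉ Icc (H.lift^[m + s] x + u) (H.lift^[m + t] x + v) := by
  rintro ⟨h1, h2⟩
  have hle := fun {m m' : ℕ} {p p' : ℤ} => CircleHomeo.iterate_lift_le_iff h.tendsto h.irrational'
    (m := m) (m' := m') (p := p) (p' := p') (x := x)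
  have h1' := (hle (m := m + s) (m' := 0) (p := u) (p' := k)).1 h1
  have h2' := (hle (m := 0) (m' := m + t) (p := k) (p' := v)).1 h2
  have hlen := h.length_eq
  have hδ := h.delta_pos
  have hs := h.left_le
  have ht := h.right_le
  have b1 := h.delta_le_abs (d := (m + s : ℕ)) (by lia) (by lia) (u - k)
  have b2 := h.delta_le_abs (d := (m + t : ℕ)) (by lia) (by lia) (v - k)
  push_cast at h1' h2' b1 b2
  rw [abs_of_nonpos (by linarith)] at b1
  rw [abs_of_nonneg (by linarith)] at b2
  linarith

end IsLiftOfIn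

/-! ### Critical times -/

theorem deriv_iterate_eq_zero {F : ℝ → ℝ} (hF : Differentiable ℝ F) {m : ℕ} {y : ℝ}
    (h : deriv F^[m] y = 0) : ∃ k < m, deriv F (F^[k] y) = 0 := by
  induction m with
  | zero => simp at h
  | succ m ih =>
    rw [Function.iterate_succ', deriv_comp _ (hF _) (hF.iterate m _)] at h
    rcases mul_eq_zero.1 h with h | h
    · exact ⟨m, m.lt_succ_self, h⟩
    · obtain ⟨k, hk, h⟩ := ih h
      exact ⟨k, hk.trans m.lt_succ_self, h⟩

theorem time_lt_cfQ_succ {α : ℝ} {n i j : ℕ} (hn : 1 ≤ n) (hi : i < cfQ α n)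
    (hj : j < cfA α (n + 1)) : i + cfQ α (n - 1) + j * cfQ α n < cfQ α (n + 1) := by
  rw [cfQ_succ hn]
  nlinarith

theorem time_inj {q r i i' j j' : ℕ} (hi : i < q) (hi' : i' < q)
    (h : i + r + j * q = i' + r + j' * q) : j = j' := by
  rcases lt_trichotomy j j' with hlt | heq | hlt
  · nlinarith
  · exact heq
  · nlinarith

namespace IsLiftOfIn

variable {f : MulticriticalCircleMap} {α β : ℝ} {n s t : ℕ} {u v : ℤ} {i0 : Fin f.N}

theorem exists_crit_mem_Icc (h : IsLiftOfIn f.toCircleHomeo α β (f.crit i0) n s t u v)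
    (hn : 1 ≤ n) {j : ℕ} (hj : j ∈ critTimesSet f α (projC (f.crit i0)) n) :
    ∃ i ≠ i0, ∃ k < cfQ α n, ∃ l : ℤ, f.crit i + l ∈
      Icc (f.lift^[k + cfQ α (n - 1) + j * cfQ α n + s] (f.crit i0) + u)
        (f.lift^[k + cfQ α (n - 1) + j * cfQ α n + t] (f.crit i0) + v) := by
  classical
  simp only [critTimesSet, Finset.mem_filter, Finset.mem_Ioo] at hj
  obtain ⟨⟨hj0, hja⟩, z, hz, y, rfl, hy⟩ := hj
  obtain ⟨w, hw, hwy⟩ := h.closure_Ini_subset _ hz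
  obtain ⟨e, rfl⟩ := projC_eq_projC_iff.1 hwy
  obtain ⟨k, hk, hyk⟩ := deriv_iterate_eq_zero (f.smooth.differentiable (by norm_num)) hy
  obtain ⟨i, l, hil⟩ := f.crit_complete _ hyk
  have hmem := f.iterate_lift_mem_Icc k _ _ hw.1 hw.2
  rw [f.iterate_lift_add_int, hil, add_assoc (f.crit i), ← Int.cast_add] at hmem
  simp only [zero_add, ← add_assoc] at hmem
  refine ⟨i, ?_, k, hk, l + e, hmem⟩
  rintro rfl
  have hq := cfQ_pos h.irrational h.mem_Ico (n - 1)
  have hlt := time_lt_cfQ_succ (j := j + 1) hn hk (by lia)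
  exact h.base_notMem_Icc (by lia) (by linarith) _ hmem

/-- A critical point lies in the closure of at most two of the arcs `I_n^m`, `m < q_{n+1}`, and the
base point does not contribute a critical time. -/
theorem card_critTimesSet_add_two_le
    (h : IsLiftOfIn f.toCircleHomeo α β (f.crit i0) n s t u v) (hn : 1 ≤ n) :
    (critTimesSet f α (projC (f.crit i0)) n).card + 2 ≤ 2 * f.N := by
  classical
  have : Nonempty (Fin f.N) := ⟨i0⟩
  choose! c hc k hk l hl using fun j => h.exists_crit_mem_Icc hn (j := j)
  let m : ℕ → ℕ := fun j => k j + cfQ α (n - 1) + j * cfQ α n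
  let b : ℕ → Bool := fun j =>
    decide (f.crit (c j) + l j = f.lift^[m j + t] (f.crit i0) + v)
  have hcard : (critTimesSet f α (projC (f.crit i0)) n).card ≤
      ((Finset.univ.erase i0) ×ˢ (Finset.univ : Finset Bool)).card := by
    refine Finset.card_le_card_of_injOn (fun j => (c j, b j)) (fun j hj => ?_)
      fun j hj j' hj' heq => ?_
    · simpa using hc j hj
    · obtain ⟨hcc, hbb⟩ := Prod.mk.inj heq
      have hlt : ∀ j ∈ critTimesSet f α (projC (f.crit i0)) n, m j < cfQ α (n + 1) := by
        intro j hj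
        refine time_lt_cfQ_succ hn (hk j hj) ?_
        simp only [critTimesSet, Finset.mem_filter, Finset.mem_Ioo] at hj
        lia
      have hpos : ∀ m, f.lift^[m + s] (f.crit i0) + u < f.lift^[m + t] (f.crit i0) + v := by
        intro m
        refine (CircleHomeo.iterate_lift_lt_iff h.tendsto h.irrational').2 ?_
        have := h.length_eq
        have := h.delta_pos
        push_cast
        linarith
      have h1 := hl j hj
      have h2 := hl j' hj'
      have p1 := hpos (m j)
      have p2 := hpos (m j')
      refine time_inj (hk j hj) (hk j' hj') (h.eq_of_overlap (k := l j') (k' := l j)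
        (hlt j hj) (hlt j' hj') ?_ ?_) <;>
      · change f.lift^[m _ + s] _ + _ + _ < f.lift^[m _ + t] _ + _ + _
        change _ ∈ Icc (f.lift^[m j + s] _ + _) (f.lift^[m j + t] _ + _) at h1
        change _ ∈ Icc (f.lift^[m j' + s] _ + _) (f.lift^[m j' + t] _ + _) at h2
        rw [← hcc] at h2
        by_cases hb : f.crit (c j) + l j = f.lift^[m j + t] (f.crit i0) + v
        · have hb' : f.crit (c j') + l j' = f.lift^[m j' + t] (f.crit i0) + v := by
            simpa [b, hb] using hbb
          rw [← hcc] at hb'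
          linarith
        · have hb' : ¬ f.crit (c j') + l j' = f.lift^[m j' + t] (f.crit i0) + v := by
            simpa [b, hb] using hbb
          rw [← hcc] at hb'
          have q1 := lt_of_le_of_ne h1.2 hb
          have q2 := lt_of_le_of_ne h2.2 hb'
          linarith [h1.1, h2.1]
  rw [Finset.card_product, Finset.card_erase_of_mem (Finset.mem_univ _), Finset.card_univ,
    Fintype.card_fin, Finset.card_univ, Fintype.card_bool] at hcard
  have := f.N_pos
  lia

end IsLiftOfIn

theorem kTime_mono (f : MulticriticalCircleMap) (α : ℝ) (x0 : Circle1) (n : ℕ) :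
    Monotone (kTime f α x0 n) ∧ ∀ s, kTime f α x0 n s ≤ cfA α (n + 1) - 1 := by
  set l := (((0 : ℕ) :: (critTimesSet f α x0 n).sort (· ≤ ·)) ++ [cfA α (n + 1) - 1]) with hl
  have hlt : ∀ j ∈ critTimesSet f α x0 n, j < cfA α (n + 1) - 1 := by
    intro j hj
    simp only [critTimesSet, Finset.mem_filter, Finset.mem_Ioo] at hj
    exact hj.1.2
  have hmem : ∀ j ∈ l, j ≤ cfA α (n + 1) - 1 := by
    intro j hj
    simp only [hl, List.mem_append, List.mem_cons, Finset.mem_sort, List.not_mem_nil,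
      or_false] at hj
    rcases hj with (rfl | hj) | rfl
    · exact Nat.zero_le _
    · exact (hlt j hj).le
    · exact le_rfl
  have hsorted : l.Pairwise (· ≤ ·) := by
    rw [hl, List.pairwise_append, List.pairwise_cons]
    refine ⟨⟨fun _ _ => Nat.zero_le _, Finset.pairwise_sort _ _⟩, List.pairwise_singleton _ _, ?_⟩
    rintro a ha b hb
    rw [List.mem_singleton.1 hb]
    exact hmem a (List.mem_append_left _ ha)
  have hle : ∀ s, kTime f α x0 n s ≤ cfA α (n + 1) - 1 := by
    intro s
    change l.getD s _ ≤ _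
    rcases lt_or_ge s l.length with h | h
    · rw [List.getD_eq_getElem _ _ h]
      exact hmem _ (List.getElem_mem h)
    · rw [List.getD_eq_default _ _ h]
  refine ⟨fun s s' hss => ?_, hle⟩
  rcases lt_or_ge s' l.length with h | h
  · rcases hss.eq_or_lt with rfl | hss
    · rfl
    change l.getD s _ ≤ l.getD s' _
    rw [List.getD_eq_getElem _ _ h, List.getD_eq_getElem _ _ (hss.trans h)]
    exact List.pairwise_iff_getElem.1 hsorted _ _ _ _ hss
  · exact (hle s).trans_eq (List.getD_eq_default _ _ h).symm

theorem kTime_rn (f : MulticriticalCircleMap) (α : ℝ) (x0 : Circle1) (n : ℕ) :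
    kTime f α x0 n (rn f α x0 n) = cfA α (n + 1) - 1 := by
  rw [kTime, rn, List.getD_append_right _ _ _ _ (by simp)]
  simp

/-! ### Measures of trimmed bridges -/

/-- The indices `j` of the arcs `Δ_j` in the trimmed bridges, each bridge being trimmed by `A`. -/
noncomputable def trimmedTimes (k : ℕ → ℕ) (A : ℝ) (r : ℕ) : Finset ℕ :=
  (Finset.range r).biUnion fun s => Finset.Ioc (k s + ⌊A⌋₊) (k (s + 1) - ⌊A⌋₊)

theorem le_card_trimmedTimes {k : ℕ → ℕ} (hk : Monotone k) {A : ℝ} (hA : 0 ≤ A) (r : ℕ) :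
    (k r : ℝ) - k 0 - 2 * r * A ≤ (trimmedTimes k A r).card := by
  have hdisj : (Finset.range r : Set ℕ).PairwiseDisjoint
      fun s => Finset.Ioc (k s + ⌊A⌋₊) (k (s + 1) - ⌊A⌋₊) := by
    intro s _ s' _ hne
    have := hk.pairwise_disjoint_on_Ioc_succ hne
    rw [Function.onFun, ← Finset.disjoint_coe, Finset.coe_Ioc, Finset.coe_Ioc]
    exact this.mono (Set.Ioc_subset_Ioc (Nat.le_add_right _ _) (Nat.sub_le _ _))
      (Set.Ioc_subset_Ioc (Nat.le_add_right _ _) (Nat.sub_le _ _))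
  have hfloor := Nat.floor_le hA
  rw [trimmedTimes, Finset.card_biUnion hdisj]
  push_cast
  have hsum : (k r : ℝ) - k 0 - 2 * r * A =
      ∑ s ∈ Finset.range r, ((k (s + 1) : ℝ) - k s - 2 * A) := by
    rw [Finset.sum_sub_distrib, Finset.sum_range_sub (fun s => (k s : ℝ))]
    simp
    ring
  rw [hsum]
  refine Finset.sum_le_sum fun s _ => ?_
  rw [Nat.card_Ioc]
  have : k (s + 1) ≤ k (s + 1) - ⌊A⌋₊ - (k s + ⌊A⌋₊) + k s + 2 * ⌊A⌋₊ := by lia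
  have : (k (s + 1) : ℝ) ≤ (k (s + 1) - ⌊A⌋₊ - (k s + ⌊A⌋₊) : ℕ) + k s + 2 * ⌊A⌋₊ := mod_cast this
  linarith

theorem exists_of_mem_trimmedTimes {k : ℕ → ℕ} {A : ℝ} {r j : ℕ}
    (hj : j ∈ trimmedTimes k A r) : ∃ s < r, k s + A < j ∧ j < k (s + 1) + 1 - A := by
  simp only [trimmedTimes, Finset.mem_biUnion, Finset.mem_range, Finset.mem_Ioc] at hj
  obtain ⟨s, hs, h1, h2⟩ := hj
  have hA := Nat.lt_floor_add_one A
  have h1' : (k s : ℝ) + ⌊A⌋₊ + 1 ≤ j := mod_cast h1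
  have h2' : (j : ℝ) + ⌊A⌋₊ ≤ k (s + 1) := by
    have : j + ⌊A⌋₊ ≤ k (s + 1) := by lia
    exact_mod_cast this
  exact ⟨s, hs, by linarith, by linarith⟩

theorem CircleHomeo.measure_image_iterate (H : CircleHomeo) {μ : Measure Circle1}
    (hμ : IsInvProbMeasure H μ) (m : ℕ) (S : Set Circle1) : μ (H.toFun^[m] '' S) = μ S := by
  induction m generalizing S with
  | zero => simp
  | succ m ih =>
    rw [Function.iterate_succ, image_comp, ih]
    have he : H.toFun = H.toHomeo.toMeasurableEquiv := rfl
    nth_rw 1 [← hμ.2, he, MeasurableEquiv.map_apply, ← he,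
      preimage_image_eq _ (show H.toFun.Injective from H.toHomeo.injective)]

theorem CircleHomeo.measurableSet_image_iterate (H : CircleHomeo) (m : ℕ) {S : Set Circle1}
    (hS : MeasurableSet S) : MeasurableSet (H.toFun^[m] '' S) := by
  induction m generalizing S with
  | zero => simpa
  | succ m ih =>
    rw [Function.iterate_succ, image_comp]
    exact ih (H.toHomeo.toMeasurableEquiv.measurableSet_image.2 hS)

theorem DynPart.measurableSet_In (H : CircleHomeo) (α : ℝ) (x0 : Circle1) (n : ℕ) :
    MeasurableSet (DynPart.In H α x0 n) := by
  rw [DynPart.In]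
  split_ifs <;> exact measurableSet_arcIco _ _

theorem DynPart.image_iterate_Ini (H : CircleHomeo) (α : ℝ) (x0 : Circle1) (n i m : ℕ) :
    H.toFun^[i] '' DynPart.Ini H α x0 n m = DynPart.Ini H α x0 n (i + m) := by
  rw [DynPart.Ini, DynPart.Ini, Function.iterate_add, image_comp]

/-- For a multicritical circle map, `μ(A^n_{i,γ}) ≥ δ_n (a_{n+1} - (4N+2) a_{n+1}^γ)`. -/
theorem stmt4 (f : MulticriticalCircleMap) (α : ℝ) (hirr : Irrational α)
    (hrot : HasRotationNumber f.toCircleHomeo α) (μ : Measure Circle1)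
    (hμ : IsInvProbMeasure f.toCircleHomeo μ)
    (huniq : ∀ ν : Measure Circle1, IsInvProbMeasure f.toCircleHomeo ν → ν = μ)
    (i0 : Fin f.N) (γ : ℝ) (hγ : γ ∈ Set.Ioo (0 : ℝ) 1) (n : ℕ) (hn : 1 ≤ n)
    (i : ℕ) (hi : i < cfQ α n) :
    (μ (DynPart.In f.toCircleHomeo α (projC (f.crit i0)) n)).toReal
        * ((cfA α (n + 1) : ℝ) - (4 * f.N + 2) * (cfA α (n + 1) : ℝ) ^ γ)
      ≤ (μ (Aset f α (projC (f.crit i0)) n i γ)).toReal := by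
  obtain ⟨β, s, t, u, v, h⟩ := exists_isLiftOfIn hirr hrot (f.crit i0) n
  have := hμ.1
  set x0 := projC (f.crit i0) with hx0
  set a := cfA α (n + 1) with ha
  set A : ℝ := (a : ℝ) ^ γ with hA
  have ha1 : 1 ≤ a := one_le_cfA hirr hrot.1 _
  have hA1 : 1 ≤ A := Real.one_le_rpow (mod_cast ha1) hγ.1.le
  obtain ⟨hmono, hle⟩ := kTime_mono f α x0 n
  set J := trimmedTimes (kTime f α x0 n) A (rn f α x0 n) with hJ
  have hJlt : ∀ j ∈ J, j < a := by
    intro j hj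
    obtain ⟨s, -, -, hs⟩ := exists_of_mem_trimmedTimes hj
    have hjk : (j : ℝ) < kTime f α x0 n (s + 1) + 1 := by linarith
    have : j < kTime f α x0 n (s + 1) + 1 := mod_cast hjk
    have := hle (s + 1)
    lia
  have hcard : (a : ℝ) - (4 * f.N + 2) * A ≤ J.card := by
    have h1 := le_card_trimmedTimes hmono (zero_le_one.trans hA1) (rn f α x0 n)
    rw [kTime_rn, ← ha, Nat.cast_sub ha1] at h1
    have h0 : kTime f α x0 n 0 = 0 := rfl
    rw [h0] at h1
    have h2 := h.card_critTimesSet_add_two_le hn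
    have h3 : (rn f α x0 n : ℝ) ≤ 2 * f.N := by
      have : rn f α x0 n ≤ 2 * f.N := by rw [rn]; lia
      exact_mod_cast this
    push_cast at h1
    nlinarith
  have hsub : ⋃ j ∈ J, DynPart.Δ f.toCircleHomeo α x0 n i j ⊆ Aset f α x0 n i γ := by
    refine iUnion₂_subset fun j hj => ?_
    obtain ⟨s, hs, h1, h2⟩ := exists_of_mem_trimmedTimes hj
    refine Subset.trans ?_ (subset_biUnion_of_mem (show s ∈ Set.Iio (rn f α x0 n) from hs))
    have hΔ : DynPart.Δ f.toCircleHomeo α x0 n i j =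
        f.toCircleHomeo.toFun^[i] '' DynPart.Δ f.toCircleHomeo α x0 n 0 j := by
      rw [DynPart.Δ, DynPart.Δ, DynPart.image_iterate_Ini, zero_add, add_assoc]
    rw [hΔ]
    exact image_mono (subset_biUnion_of_mem (u := fun j => DynPart.Δ f.toCircleHomeo α x0 n 0 j)
      (show j ∈ {j : ℕ | _ ∧ _} from ⟨h1, h2⟩))
  have hmeas : μ.real (⋃ j ∈ J, DynPart.Δ f.toCircleHomeo α x0 n i j) =
      J.card * μ.real (DynPart.In f.toCircleHomeo α x0 n) := by
    rw [measureReal_biUnion_finset]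
    · simp only [DynPart.Δ, DynPart.Ini, measureReal_def, CircleHomeo.measure_image_iterate _ hμ,
        Finset.sum_const, nsmul_eq_mul]
    · intro j hj j' hj' hne
      exact h.disjoint_Ini (time_lt_cfQ_succ hn hi (hJlt j hj))
        (time_lt_cfQ_succ hn hi (hJlt j' hj')) fun heq => hne (time_inj hi hi heq)
    · exact fun j _ =>
        CircleHomeo.measurableSet_image_iterate _ _ (DynPart.measurableSet_In _ _ _ _)
  calc μ.real (DynPart.In f.toCircleHomeo α x0 n) * (a - (4 * f.N + 2) * A)
      ≤ μ.real (DynPart.In f.toCircleHomeo α x0 n) * J.card := by gcongr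
    _ = μ.real (⋃ j ∈ J, DynPart.Δ f.toCircleHomeo α x0 n i j) := by rw [hmeas, mul_comm]
    _ ≤ μ.real (Aset f α x0 n i γ) := measureReal_mono hsub
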